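/- arXiv:2410.05457 — 3 statements merged into one kernel-verified Lean document; each statement's English description precedes it below -/
import Mathlib

section
/- Let (M, d) be a metric space and let X ⊆ M be a compact and connected subset. Then X is Lipschitz normally embedded (LNE) in (M, d) if and only if X is locally LNE, i.e. locally LNE at every point of X. (Proposition 3.1 of the paper; the paper notes the proof is purely metric in nature.) -/
open ENNReal

/-- The length of the path `c : [a, b] → α` with respect to the (pseudo-)distance `d`:
the supremum, over all partitions `a = t₀ ≤ ⋯ ≤ t_k = b`, of `Σ d (c tᵢ₋₁) (c tᵢ)`. -/
noncomputable def pathLength {α : Type*} (d : α → α → ℝ≥0∞) (c : ℝ → α) (a b : ℝ) : ℝ≥0∞ :=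
  ⨆ p : {q : ℕ × (ℕ → ℝ) // Monotone q.2 ∧ q.2 0 = a ∧ q.2 q.1 = b},
    ∑ i ∈ Finset.range p.1.1, d (c (p.1.2 i)) (c (p.1.2 (i + 1)))

/-- Continuity of the path `c : [a, b] → α` with respect to the (pseudo-)distance `d`. -/
def ContWRT {α : Type*} (d : α → α → ℝ≥0∞) (c : ℝ → α) (a b : ℝ) : Prop :=
  ∀ t ∈ Set.Icc a b, ∀ ε : ℝ≥0∞, 0 < ε →
    ∃ δ : ℝ, 0 < δ ∧ ∀ s ∈ Set.Icc a b, |s - t| < δ → d (c s) (c t) < ε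

/-- The inner distance of `x, y` in the subset `X`, with respect to the
(pseudo-)distance `d`: the infimum of lengths of continuous paths within `X`
joining `x` to `y` (`∞` if there is no such path of finite length). -/
noncomputable def innerDist {α : Type*} (d : α → α → ℝ≥0∞) (X : Set α) (x y : α) : ℝ≥0∞ :=
  sInf { L : ℝ≥0∞ | ∃ (a b : ℝ) (c : ℝ → α), a ≤ b ∧ ContWRT d c a b ∧
    (∀ t ∈ Set.Icc a b, c t ∈ X) ∧ c a = x ∧ c b = y ∧ L = pathLength d c a b }

/-- `X` is Lipschitz normally embedded with respect to the (pseudo-)distance `d`: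
there is `L ≥ 1` with `d_inn^X(x, y) ≤ L·d(x, y)` for all `x, y ∈ X`. -/
def IsLNE {α : Type*} (d : α → α → ℝ≥0∞) (X : Set α) : Prop :=
  ∃ L : ℝ, 1 ≤ L ∧ ∀ x ∈ X, ∀ y ∈ X, innerDist d X x y ≤ ENNReal.ofReal L * d x y

theorem aux_len {M : Type*} [MetricSpace M] (c : ℝ → M) (a b : ℝ) (hab : a ≤ b) :
    pathLength edist c a b = eVariationOn c (Set.Icc a b) := by
  apply le_antisymm
  · unfold pathLength
    apply iSup_le
    rintro ⟨⟨n, u⟩, hm, h0, hn⟩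
    simp only at hm h0 hn ⊢
    calc _ = ∑ i ∈ Finset.range n, edist (c (u (i+1))) (c (u i)) := by
            simp only [edist_comm]
      _ ≤ _ := by
        apply eVariationOn.sum_le_of_monotoneOn_Iic
        · exact hm.monotoneOn _
        · intro i hi
          exact ⟨h0 ▸ hm (Nat.zero_le i), hn ▸ hm hi⟩
  · unfold eVariationOn
    apply iSup_le
    rintro ⟨n, ⟨u, hm, hu⟩⟩
    simp only
    let v : ℕ → ℝ := fun i => if i = 0 then a else if i ≤ n + 1 then u (i - 1) else b
    have hv : Monotone v := by
      intro i j hij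
      simp only [v]
      split_ifs with h1 h2 h3 h4 h5 h6
      all_goals first
        | exact le_rfl
        | exact (hu _).1
        | exact (hu _).2
        | exact hab
        | omega
        | exact hm (by omega)
    have hv0 : v 0 = a := by simp [v]
    have hvn : v (n + 2) = b := by simp [v]
    refine le_trans ?_ (le_iSup (fun p : {q : ℕ × (ℕ → ℝ) // Monotone q.2 ∧ q.2 0 = a ∧ q.2 q.1 = b} =>
      ∑ i ∈ Finset.range p.1.1, edist (c (p.1.2 i)) (c (p.1.2 (i + 1)))) ⟨(n + 2, v), hv, hv0, hvn⟩)
    simp only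
    rw [Finset.sum_range_succ, Finset.sum_range_succ']
    refine le_trans (le_of_eq ?_) (le_trans le_self_add le_self_add)
    apply Finset.sum_congr rfl
    intro i hi
    have hi := Finset.mem_range.1 hi
    have e1 : v (i + 1) = u i := by simp only [v]; rw [if_neg (by omega), if_pos (by omega)]; rfl
    have e2 : v (i + 1 + 1) = u (i + 1) := by
      simp only [v]; rw [if_neg (by omega), if_pos (by omega)]; rfl
    rw [e1, e2, edist_comm]

theorem aux_cont {M : Type*} [MetricSpace M] (c : ℝ → M) (a b : ℝ) :
    ContWRT edist c a b ↔ ContinuousOn c (Set.Icc a b) := by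
  constructor
  · intro h
    rw [EMetric.continuousOn_iff]
    intro t ht ε hε
    obtain ⟨δ, hδ, h⟩ := h t ht ε hε
    refine ⟨ENNReal.ofReal δ, by simpa using hδ, fun s hs hst => h s hs ?_⟩
    rw [edist_dist, ENNReal.ofReal_lt_ofReal_iff hδ, Real.dist_eq] at hst
    exact hst
  · intro h t ht ε hε
    have := (h t ht).eventually (Metric.eball_mem_nhds (c t) hε)
    rw [eventually_nhdsWithin_iff, Metric.eventually_nhds_iff] at this
    obtain ⟨δ, hδ, h⟩ := this
    exact ⟨δ, hδ, fun s hs hst => h (by rwa [Real.dist_eq]) hs⟩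

theorem aux_tri {M : Type*} [MetricSpace M] (X : Set M) (x y z : M) :
    innerDist edist X x z ≤ innerDist edist X x y + innerDist edist X y z := by
  conv_rhs => unfold innerDist
  rw [ENNReal.sInf_add]
  refine le_iInf₂ fun L1 h1 => ?_
  rw [add_comm, ENNReal.sInf_add]
  refine le_iInf₂ fun L2 h2 => ?_
  obtain ⟨a, b, c, hab, hc, hX, hca, hcb, rfl⟩ := h1
  obtain ⟨a', b', c', hab', hc', hX', hca', hcb', rfl⟩ := h2
  rw [aux_cont] at hc hc'
  rw [aux_len _ _ _ hab, aux_len _ _ _ hab', add_comm]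
  let B := b + (b' - a')
  have hB : b ≤ B := by simp only [B]; linarith
  let f : ℝ → M := fun t => if t ≤ b then c t else c' (t - b + a')
  have f1 : Set.EqOn f c (Set.Icc a b) := fun t ht => by simp [f, ht.2]
  have f2 : Set.EqOn f (c' ∘ fun t => t - b + a') (Set.Icc b B) := fun t ht => by
    rcases eq_or_lt_of_le ht.1 with h | h
    · subst h; simp [f, hcb, hca']
    · simp [f, not_le.2 h]
  have hmap : Set.MapsTo (fun t => t - b + a') (Set.Icc b B) (Set.Icc a' b') := fun t ht => by
    have := ht.1; have := ht.2
    simp only [B] at *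
    constructor <;> linarith
  have hun : Set.Icc a B = Set.Icc a b ∪ Set.Icc b B := (Set.Icc_union_Icc_eq_Icc hab hB).symm
  refine le_trans (sInf_le ⟨a, B, f, hab.trans hB, ?_, ?_, ?_, ?_, rfl⟩) ?_
  · rw [aux_cont, hun]
    refine ContinuousOn.union_of_isClosed (hc.congr f1) ?_ isClosed_Icc isClosed_Icc
    exact (hc'.comp (by fun_prop) hmap).congr f2
  · intro t ht
    rw [hun] at ht
    rcases ht with ht | ht
    · rw [f1 ht]; exact hX _ ht
    · rw [f2 ht]; exact hX' _ (hmap ht)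
  · rw [f1 ⟨le_rfl, hab⟩, hca]
  · rw [f2 ⟨hB, le_rfl⟩, ← hcb']; simp [B]
  · rw [aux_len _ _ _ (hab.trans hB), ← Set.univ_inter (Set.Icc a B),
      ← eVariationOn.Icc_add_Icc f hab hB (Set.mem_univ _), Set.univ_inter, Set.univ_inter,
      eVariationOn.congr f1, eVariationOn.congr f2]
    gcongr
    apply eVariationOn.comp_le_of_monotoneOn _ _ _ hmap
    intro s _ t _ h
    simpa using h

theorem aux_mono {M : Type*} [MetricSpace M] {X Y : Set M} (h : X ⊆ Y) (x y : M) :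
    innerDist edist Y x y ≤ innerDist edist X x y := by
  apply sInf_le_sInf
  rintro L ⟨a, b, c, hab, hc, hX, hca, hcb, rfl⟩
  exact ⟨a, b, c, hab, hc, fun t ht => h (hX t ht), hca, hcb, rfl⟩

theorem aux_main {M : Type*} [MetricSpace M] (X : Set M)
    (hcomp : IsCompact X) (hconn : IsConnected X)
    (H : ∀ p ∈ X, ∃ U : Set M, U ∈ nhds p ∧ ∃ L : ℝ, ∀ x ∈ X ∩ U, ∀ y ∈ X ∩ U,
      innerDist edist X x y ≤ ENNReal.ofReal L * edist x y) : IsLNE edist X := by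
  have fin1 : ∀ x ∈ X, ∀ y ∈ X, innerDist edist X x y < ∞ := by
    intro x hx y hy
    refine hconn.isPreconnected.induction₂' (fun x y => innerDist edist X x y < ∞) ?_ ?_ hx hy
    · intro p hp
      obtain ⟨U, hU, L, hL⟩ := H p hp
      filter_upwards [inter_mem_nhdsWithin X hU] with q hq
      have hp' : p ∈ X ∩ U := ⟨hp, mem_of_mem_nhds hU⟩
      exact ⟨(hL p hp' q hq).trans_lt (by finiteness), (hL q hq p hp').trans_lt (by finiteness)⟩
    · intro x y z _ _ _ h1 h2
      exact (aux_tri X x y z).trans_lt (ENNReal.add_lt_top.2 ⟨h1, h2⟩)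
  suffices h : ∃ L : ℝ, ∀ z ∈ X ×ˢ X, innerDist edist X z.1 z.2 ≤ ENNReal.ofReal L * edist z.1 z.2 by
    obtain ⟨L, hL⟩ := h
    refine ⟨max 1 L, le_max_left _ _, fun x hx y hy => (hL (x, y) ⟨hx, hy⟩).trans ?_⟩
    gcongr
    exact le_max_right _ _
  refine (hcomp.prod hcomp).induction_on (p := fun S : Set (M × M) => ∃ L : ℝ, ∀ z ∈ S, innerDist edist X z.1 z.2 ≤ ENNReal.ofReal L * edist z.1 z.2) ?_ ?_ ?_ ?_
  · exact ⟨1, by simp⟩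
  · rintro s t hst ⟨L, hL⟩
    exact ⟨L, fun z hz => hL z (hst hz)⟩
  · rintro s t ⟨L, hL⟩ ⟨L', hL'⟩
    refine ⟨max L L', fun z hz => ?_⟩
    rcases hz with hz | hz
    · refine (hL z hz).trans ?_
      gcongr
      exact le_max_left _ _
    · refine (hL' z hz).trans ?_
      gcongr
      exact le_max_right _ _
  · rintro ⟨p, q⟩ ⟨hp, hq⟩
    simp only at hp hq
    by_cases hpq : p = q
    · subst hpq
      obtain ⟨U, hU, L, hL⟩ := H p hp
      refine ⟨(X ×ˢ X) ∩ (U ×ˢ U), inter_mem_nhdsWithin _ (prod_mem_nhds hU hU), L, ?_⟩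
      rintro ⟨x, y⟩ ⟨⟨hx, hy⟩, hx', hy'⟩
      exact hL x ⟨hx, hx'⟩ y ⟨hy, hy'⟩
    · obtain ⟨U, hU, L, hL⟩ := H p hp
      obtain ⟨V, hV, K, hK⟩ := H q hq
      have hd : 0 < dist p q := dist_pos.2 hpq
      set r := dist p q / 3 with hr
      have hr0 : 0 < r := by positivity
      set C : ℝ≥0∞ := ENNReal.ofReal L * ENNReal.ofReal r + innerDist edist X p q
        + ENNReal.ofReal K * ENNReal.ofReal r with hC
      have hCt : C ≠ ∞ := by
        have := (fin1 p hp q hq).ne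
        finiteness
      refine ⟨(X ×ˢ X) ∩ ((U ∩ Metric.ball p r) ×ˢ (V ∩ Metric.ball q r)),
        inter_mem_nhdsWithin _ (prod_mem_nhds (Filter.inter_mem hU (Metric.ball_mem_nhds p hr0))
          (Filter.inter_mem hV (Metric.ball_mem_nhds q hr0))), C.toReal / r, ?_⟩
      rintro ⟨x, y⟩ ⟨⟨hx, hy⟩, ⟨hxU, hxp⟩, hyV, hyq⟩
      simp only at hx hy hxU hxp hyV hyq ⊢
      rw [Metric.mem_ball] at hxp hyq
      have hxy : r ≤ dist x y := by
        have h1 := dist_triangle4 p x y q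
        rw [dist_comm p x] at h1
        linarith
      have b1 : innerDist edist X x p ≤ ENNReal.ofReal L * ENNReal.ofReal r := by
        refine (hL x ⟨hx, hxU⟩ p ⟨hp, mem_of_mem_nhds hU⟩).trans ?_
        rw [edist_dist]
        gcongr
      have b2 : innerDist edist X q y ≤ ENNReal.ofReal K * ENNReal.ofReal r := by
        refine (hK q ⟨hq, mem_of_mem_nhds hV⟩ y ⟨hy, hyV⟩).trans ?_
        rw [edist_dist, dist_comm]
        gcongr
      calc innerDist edist X x y ≤ innerDist edist X x q + innerDist edist X q y := aux_tri _ _ _ _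
        _ ≤ innerDist edist X x p + innerDist edist X p q + innerDist edist X q y := by
          gcongr; exact aux_tri _ _ _ _
        _ ≤ C := by rw [hC]; gcongr
        _ = ENNReal.ofReal (C.toReal / r * r) := by
          rw [div_mul_cancel₀ _ hr0.ne', ENNReal.ofReal_toReal hCt]
        _ ≤ ENNReal.ofReal (C.toReal / r * dist x y) := by gcongr
        _ = _ := by rw [ENNReal.ofReal_mul (by positivity), edist_dist]

theorem statement_1 {M : Type*} [MetricSpace M] (X : Set M)
    (hcomp : IsCompact X) (hconn : IsConnected X) :
    IsLNE edist X ↔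
      ∀ p ∈ X, ∃ U : Set M, U ∈ nhds p ∧ IsLNE edist (X ∩ U) := by
  constructor
  · intro h p _
    exact ⟨Set.univ, Filter.univ_mem, by rwa [Set.inter_univ]⟩
  · intro h
    apply aux_main X hcomp hconn
    intro p hp
    obtain ⟨U, hU, L, _, hL⟩ := h p hp
    exact ⟨U, hU, L, fun x hx y hy =>
      (aux_mono Set.inter_subset_left x y).trans (hL x hx y hy)⟩
end

section
/- Let (N, d_N) be a metric space and let Y ⊆ N be an LNE subset of (N, d_N). Let η > 0 and let d be a distance on the open cylinder Q = N × (0, η) for which there exist constants 0 < A ≤ B such that A·(|r − r'| + min(r, r')·d_N(y, y')) ≤ d((y, r), (y', r')) ≤ B·(|r − r'| + min(r, r')·d_N(y, y')) for all (y, r), (y', r') ∈ Q. Then there exists η_Y ∈ (0, η) such that for every 0 < ε ≤ η_Y the subset Y × (0, ε] is LNE in (Q, d). (This is the metric content of Proposition 3.3 of the paper: cylinders over LNE subsets are LNE for conic distances.) -/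
open ENNReal

lemma cyl_path_bound {N : Type*} [MetricSpace N] (d : N × ℝ → N × ℝ → ℝ) (η B m : ℝ)
    (hη : 0 < η) (hB : 0 < B) (hm0 : 0 < m)
    (hup : ∀ p q : N × ℝ, p.2 ∈ Set.Ioo 0 η → q.2 ∈ Set.Ioo 0 η →
      d p q ≤ B * (|p.2 - q.2| + min p.2 q.2 * dist p.1 q.1))
    (c : ℝ → N) (a b : ℝ) (hc : ContWRT edist c a b)
    (a0 b0 : ℝ) (φ ρ u : ℝ → ℝ) (hφm : Monotone φ) (hφc : Continuous φ)
    (hφa : φ a0 = a) (hφb : φ b0 = b) (hρc : Continuous ρ)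
    (hρ : ∀ t ∈ Set.Icc a0 b0, ρ t ∈ Set.Ioo 0 η)
    (hu : ∀ s t, s ≤ t → |ρ s - ρ t| ≤ u t - u s)
    (hm : ∀ s t, s ≤ t → s ∈ Set.Icc a0 b0 → t ∈ Set.Icc a0 b0 →
      min (ρ s) (ρ t) * dist (c (φ s)) (c (φ t)) ≤ m * dist (c (φ s)) (c (φ t))) :
    ContWRT (fun p q => ENNReal.ofReal (d p q)) (fun t => (c (φ t), ρ t)) a0 b0 ∧
    pathLength (fun p q => ENNReal.ofReal (d p q)) (fun t => (c (φ t), ρ t)) a0 b0 ≤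
      ENNReal.ofReal B * (ENNReal.ofReal (u b0 - u a0) +
        ENNReal.ofReal m * pathLength edist c a b) := by
  have hmaps : Set.MapsTo φ (Set.Icc a0 b0) (Set.Icc a b) := by
    intro t ht
    exact ⟨hφa ▸ hφm ht.1, hφb ▸ hφm ht.2⟩
  constructor
  · have hcc : ContinuousOn c (Set.Icc a b) := by
      intro t ht
      rw [ContinuousWithinAt, EMetric.tendsto_nhdsWithin_nhds]
      intro ε hε
      obtain ⟨δ, hδ, h⟩ := hc t ht ε hε
      refine ⟨ENNReal.ofReal δ, by simpa using hδ, fun {s} hs hst => h s hs ?_⟩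
      rw [edist_dist, ENNReal.ofReal_lt_ofReal_iff hδ, Real.dist_eq] at hst
      exact hst
    have hcφ : ContinuousOn (fun t => c (φ t)) (Set.Icc a0 b0) :=
      hcc.comp hφc.continuousOn hmaps
    intro t ht ε hε
    have hF : ContinuousOn (fun s => ENNReal.ofReal
        (B * (|ρ s - ρ t| + η * dist (c (φ s)) (c (φ t))))) (Set.Icc a0 b0) := by
      apply ENNReal.continuous_ofReal.comp_continuousOn
      apply continuousOn_const.mul
      apply ContinuousOn.add
      · exact (hρc.sub continuous_const).abs.continuousOn
      · exact continuousOn_const.mul (continuous_dist.comp_continuousOn (hcφ.prodMk continuousOn_const))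
    have h1 := (hF t ht).eventually_lt (continuousWithinAt_const (b := ε)) (by simpa using hε)
    obtain ⟨δ, hδ, h⟩ := Metric.mem_nhdsWithin_iff.1 h1
    refine ⟨δ, hδ, fun s hs hst => lt_of_le_of_lt (ENNReal.ofReal_le_ofReal ?_)
      (h ⟨by simpa [Real.dist_eq] using hst, hs⟩)⟩
    refine (hup _ _ (hρ s hs) (hρ t ht)).trans ?_
    have : min (ρ s) (ρ t) ≤ η := (min_le_left _ _).trans (hρ s hs).2.le
    dsimp only
    gcongr
  · refine iSup_le ?_
    rintro ⟨⟨n, q⟩, hq, hq0, hqn⟩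
    dsimp only at hq hq0 hqn ⊢
    have hmem : ∀ i ≤ n, q i ∈ Set.Icc a0 b0 := fun i hi =>
      ⟨hq0 ▸ hq (Nat.zero_le i), hqn ▸ hq hi⟩
    have hle : ∀ i ∈ Finset.range n,
        ENNReal.ofReal (d (c (φ (q i)), ρ (q i)) (c (φ (q (i+1))), ρ (q (i+1)))) ≤
        ENNReal.ofReal B * (ENNReal.ofReal (u (q (i+1)) - u (q i)) +
          ENNReal.ofReal m * edist (c (φ (q i))) (c (φ (q (i+1))))) := by
      intro i hi
      have hi := Finset.mem_range.1 hi
      have h0 := hmem i hi.le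
      have h1 := hmem (i+1) hi
      have h01 := hq (Nat.le_succ i)
      have hu' := hu _ _ h01
      rw [edist_dist, ← ENNReal.ofReal_mul hm0.le, ← ENNReal.ofReal_add
        ((abs_nonneg _).trans hu') (by positivity), ← ENNReal.ofReal_mul hB.le]
      apply ENNReal.ofReal_le_ofReal
      refine (hup _ _ (hρ _ h0) (hρ _ h1)).trans ?_
      exact mul_le_mul_of_nonneg_left (add_le_add hu' (hm _ _ h01 h0 h1)) hB.le
    refine (Finset.sum_le_sum hle).trans ?_
    rw [← Finset.mul_sum, Finset.sum_add_distrib, ← Finset.mul_sum,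
      ← ENNReal.ofReal_sum_of_nonneg
        (fun i _ => (abs_nonneg _).trans (hu _ _ (hq (Nat.le_succ i)))),
      Finset.sum_range_sub (fun i => u (q i)), hq0, hqn]
    gcongr
    exact le_iSup (fun p : {q : ℕ × (ℕ → ℝ) // Monotone q.2 ∧ q.2 0 = a ∧ q.2 q.1 = b} =>
      ∑ i ∈ Finset.range p.1.1, edist (c (p.1.2 i)) (c (p.1.2 (i + 1))))
      ⟨(n, fun i => φ (q i)), hφm.comp hq, by simp [hq0, hφa], by simp [hqn, hφb]⟩

/-!
Statement 3 (metric content of Proposition 3.3 of the paper): if `Y` is an LNE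
subset of the metric space `(N, d_N)` and `d` is a distance on the open cylinder
`Q = N × (0, η)` two-sidedly comparable with the model conic comparison expression
`|r − r'| + min(r, r')·d_N(y, y')`, then there is `η_Y ∈ (0, η)` such that the
cylinder `Y × (0, ε]` is LNE in `(Q, d)` for every `0 < ε ≤ η_Y`.
-/
theorem statement_3 {N : Type*} [MetricSpace N] (Y : Set N) (hY : IsLNE edist Y)
    (η : ℝ) (hη : 0 < η) (d : N × ℝ → N × ℝ → ℝ)
    -- `d` is a distance on `Q = N × (0, η)`
    (hsymm : ∀ p q : N × ℝ, p.2 ∈ Set.Ioo 0 η → q.2 ∈ Set.Ioo 0 η → d p q = d q p)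
    (htri : ∀ p q s : N × ℝ, p.2 ∈ Set.Ioo 0 η → q.2 ∈ Set.Ioo 0 η → s.2 ∈ Set.Ioo 0 η →
      d p s ≤ d p q + d q s)
    (A B : ℝ) (hA : 0 < A) (hAB : A ≤ B)
    (hlow : ∀ p q : N × ℝ, p.2 ∈ Set.Ioo 0 η → q.2 ∈ Set.Ioo 0 η →
      A * (|p.2 - q.2| + min p.2 q.2 * dist p.1 q.1) ≤ d p q)
    (hup : ∀ p q : N × ℝ, p.2 ∈ Set.Ioo 0 η → q.2 ∈ Set.Ioo 0 η →
      d p q ≤ B * (|p.2 - q.2| + min p.2 q.2 * dist p.1 q.1)) :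
    ∃ ηY : ℝ, 0 < ηY ∧ ηY < η ∧ ∀ ε : ℝ, 0 < ε → ε ≤ ηY →
      IsLNE (fun p q => ENNReal.ofReal (d p q))
        {p : N × ℝ | p.1 ∈ Y ∧ p.2 ∈ Set.Ioc 0 ε} := by
  obtain ⟨L, hL, hLNE⟩ := hY
  have hB : 0 < B := hA.trans_le hAB
  refine ⟨η / 2, by linarith, by linarith, fun ε hε hεη => ⟨B * L / A, ?_, ?_⟩⟩
  · rw [le_div_iff₀ hA]; nlinarith
  rintro ⟨y, r⟩ ⟨hy, hr⟩ ⟨y', r'⟩ ⟨hy', hr'⟩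
  dsimp only at hy hr hy' hr'
  have hrη : r ∈ Set.Ioo 0 η := ⟨hr.1, by linarith [hr.2]⟩
  have hrη' : r' ∈ Set.Ioo 0 η := ⟨hr'.1, by linarith [hr'.2]⟩
  have hm0 : 0 < min r r' := lt_min hr.1 hr'.1
  set X : Set (N × ℝ) := {p : N × ℝ | p.1 ∈ Y ∧ p.2 ∈ Set.Ioc 0 ε} with hX
  have key : ∀ (a b : ℝ) (c : ℝ → N), a ≤ b → ContWRT edist c a b →
      (∀ t ∈ Set.Icc a b, c t ∈ Y) → c a = y → c b = y' →
      innerDist (fun p q => ENNReal.ofReal (d p q)) X (y, r) (y', r') ≤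
        ENNReal.ofReal B * (ENNReal.ofReal |r - r'| +
          ENNReal.ofReal (min r r') * pathLength edist c a b) := by
    intro a b c hab hc hcY hca hcb
    rcases le_total r r' with h | h
    · have hρ' : ∀ t ∈ Set.Icc a (b+1), r + (r' - r) * max (t - b) 0 ∈ Set.Icc r r' := by
        intro t ht
        have h1 : max (t - b) 0 ≤ 1 := max_le (by linarith [ht.2]) zero_le_one
        have h2 : 0 ≤ max (t - b) 0 := le_max_right _ _
        constructor <;> nlinarith
      have hu : ∀ s t, s ≤ t → |(r + (r' - r) * max (s - b) 0) - (r + (r' - r) * max (t - b) 0)|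
          ≤ (r' - r) * max (t - b) 0 - (r' - r) * max (s - b) 0 := by
        intro s t hst
        have h1 : max (s - b) 0 ≤ max (t - b) 0 := max_le_max (by linarith) le_rfl
        have h2 : 0 ≤ r' - r := by linarith
        rw [abs_le]
        constructor <;> nlinarith
      obtain ⟨h1, h2⟩ := cyl_path_bound d η B (min r r') hη hB hm0 hup c a b hc a (b+1)
        (fun t => min t b) (fun t => r + (r' - r) * max (t - b) 0)
        (fun t => (r' - r) * max (t - b) 0)
        (fun s t hst => min_le_min hst le_rfl) (by fun_prop) (by simp [hab]) (by simp)
        (by fun_prop)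
        (fun t ht => ⟨hr.1.trans_le (hρ' t ht).1, (hρ' t ht).2.trans_lt hrη'.2⟩) hu
        (by
          intro s t hst hs ht
          try dsimp only
          rcases le_total b s with hbs | hbs
          · rw [min_eq_right hbs, min_eq_right (hbs.trans hst)]; simp
          · refine mul_le_mul_of_nonneg_right ?_ dist_nonneg
            rw [max_eq_right (by linarith : s - b ≤ 0), min_eq_left h]
            simp)
      refine le_trans ?_ (h2.trans ?_)
      · refine sInf_le ⟨a, b+1, _, by linarith, h1, ?_, ?_, ?_, rfl⟩
        · intro t ht
          exact ⟨hcY _ ⟨le_min ht.1 hab, min_le_right _ _⟩, hr.1.trans_le (hρ' t ht).1,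
            (hρ' t ht).2.trans hr'.2⟩
        · simp [hab, hca]
        · simp [hcb]
      · try dsimp only
        rw [max_eq_right (by linarith : a - b ≤ 0), abs_sub_comm, abs_of_nonneg (by linarith)]
        simp
    · have hρ' : ∀ t ∈ Set.Icc (a-1) b, r' + (r' - r) * min (t - a) 0 ∈ Set.Icc r' r := by
        intro t ht
        have h1 : -1 ≤ min (t - a) 0 := le_min (by linarith [ht.1]) (by norm_num)
        have h2 : min (t - a) 0 ≤ 0 := min_le_right _ _
        constructor <;> nlinarith
      have hu : ∀ s t, s ≤ t → |(r' + (r' - r) * min (s - a) 0) - (r' + (r' - r) * min (t - a) 0)|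
          ≤ (r - r') * min (t - a) 0 - (r - r') * min (s - a) 0 := by
        intro s t hst
        have h1 : min (s - a) 0 ≤ min (t - a) 0 := min_le_min (by linarith) le_rfl
        have h2 : 0 ≤ r - r' := by linarith
        rw [abs_le]
        constructor <;> nlinarith
      obtain ⟨h1, h2⟩ := cyl_path_bound d η B (min r r') hη hB hm0 hup c a b hc (a-1) b
        (fun t => max t a) (fun t => r' + (r' - r) * min (t - a) 0)
        (fun t => (r - r') * min (t - a) 0)
        (fun s t hst => max_le_max hst le_rfl) (by fun_prop) (by simp) (by simp [hab])
        (by fun_prop)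
        (fun t ht => ⟨hr'.1.trans_le (hρ' t ht).1, (hρ' t ht).2.trans_lt hrη.2⟩) hu
        (by
          intro s t hst hs ht
          try dsimp only
          rcases le_total t a with hta | hta
          · rw [max_eq_right hta, max_eq_right (hst.trans hta)]; simp
          · refine mul_le_mul_of_nonneg_right ?_ dist_nonneg
            rw [min_eq_right (by linarith : 0 ≤ t - a), min_eq_right h]
            simp)
      refine le_trans ?_ (h2.trans ?_)
      · refine sInf_le ⟨a-1, b, _, by linarith, h1, ?_, ?_, ?_, rfl⟩
        · intro t ht
          exact ⟨hcY _ ⟨le_max_right _ _, max_le ht.2 hab⟩, hr'.1.trans_le (hρ' t ht).1,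
            (hρ' t ht).2.trans hr.2⟩
        · simp [hca]
        · simp [hab, hcb]
      · try dsimp only
        rw [min_eq_right (by linarith : 0 ≤ b - a), abs_of_nonneg (by linarith)]
        simp
  have key2 : innerDist (fun p q => ENNReal.ofReal (d p q)) X (y, r) (y', r') ≤
      ENNReal.ofReal B * (ENNReal.ofReal |r - r'| +
          ENNReal.ofReal (min r r') * innerDist edist Y y y') := by
    have hcont : Continuous (fun x : ℝ≥0∞ => ENNReal.ofReal B * (ENNReal.ofReal |r - r'| +
          ENNReal.ofReal (min r r') * x)) := by
      have h1 := ENNReal.continuous_const_mul (a := ENNReal.ofReal (min r r')) ENNReal.ofReal_ne_top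
      have h2 := ENNReal.continuous_const_mul (a := ENNReal.ofReal B) ENNReal.ofReal_ne_top
      exact h2.comp (continuous_const.add h1)
    have hne : { L : ℝ≥0∞ | ∃ (a b : ℝ) (c : ℝ → N), a ≤ b ∧ ContWRT edist c a b ∧
      (∀ t ∈ Set.Icc a b, c t ∈ Y) ∧ c a = y ∧ c b = y' ∧ L = pathLength edist c a b }.Nonempty := by
      by_contra hemp
      rw [Set.not_nonempty_iff_eq_empty] at hemp
      have := hLNE y hy y' hy'
      rw [innerDist, hemp, sInf_empty, top_le_iff] at this
      exact ENNReal.mul_ne_top ENNReal.ofReal_ne_top (edist_ne_top _ _) this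
    have hcl := csInf_mem_closure hne (OrderBot.bddBelow _)
    refine closure_minimal (t := {x | innerDist (fun p q => ENNReal.ofReal (d p q)) X (y, r) (y', r')
      ≤ ENNReal.ofReal B * (ENNReal.ofReal |r - r'| + ENNReal.ofReal (min r r') * x)}) ?_
      (isClosed_le continuous_const hcont) hcl
    rintro _ ⟨a, b, c, h1, h2, h3, h4, h5, rfl⟩
    exact key a b c h1 h2 h3 h4 h5
  refine key2.trans ?_
  calc _ ≤ ENNReal.ofReal B * (ENNReal.ofReal |r - r'| +
          ENNReal.ofReal (min r r') * (ENNReal.ofReal L * edist y y')) := by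
        gcongr
        exact hLNE y hy y' hy'
    _ = ENNReal.ofReal (B * (|r - r'| + min r r' * (L * dist y y'))) := by
        rw [edist_dist, ← ENNReal.ofReal_mul (by linarith), ← ENNReal.ofReal_mul hm0.le,
          ← ENNReal.ofReal_add (abs_nonneg _) (by positivity), ← ENNReal.ofReal_mul hB.le]
    _ ≤ _ := by
        rw [← ENNReal.ofReal_mul (by positivity)]
        apply ENNReal.ofReal_le_ofReal
        have h := hlow (y, r) (y', r') hrη hrη'
        dsimp only at h
        have h3 : |r - r'| ≤ L * |r - r'| := le_mul_of_one_le_left (abs_nonneg _) hL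
        calc _ ≤ B * (L * |r - r'| + min r r' * (L * dist y y')) := by gcongr
          _ = B * L / A * (A * (|r - r'| + min r r' * dist y y')) := by field_simp
          _ ≤ _ := by gcongr
end

section
/- For (x, y) ∈ ℝ², let Q_{(x,y)} be the quadratic form on ℝ² given by Q_{(x,y)}(u, v) = (2x² − 2xy + y²)·u² + 2(x² + xy − y²)·uv + (x² + 2xy + 2y²)·v². Then there exist constants 0 < a ≤ b such that for all (x, y) ∈ ℝ² and all (u, v) ∈ ℝ²: a·(x² + y²)·(u² + v²) ≤ Q_{(x,y)}(u, v) ≤ b·(x² + y²)·(u² + v²). In particular, Q_{(x,y)} is positive definite for every (x, y) ≠ (0, 0). (This is the claim in Section 3.4 of the paper that the singular Riemannian metric h = [2x² − 2xy + y²]dx² + 2[x² + xy − y²]dx dy + [x² + 2xy + 2y²]dy² is equivalent to r²·eucl over ℝ², where r² = x² + y².) -/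
/-- The quadratic form of the singular Riemannian metric
`h = [2x² − 2xy + y²]dx² + 2[x² + xy − y²]dx dy + [x² + 2xy + 2y²]dy²`
at the base point `(x, y)`, evaluated on the vector `(u, v)`. -/
def Qform (x y u v : ℝ) : ℝ :=
  (2 * x ^ 2 - 2 * x * y + y ^ 2) * u ^ 2 +
    2 * (x ^ 2 + x * y - y ^ 2) * (u * v) +
    (x ^ 2 + 2 * x * y + 2 * y ^ 2) * v ^ 2

/-!
Statement 7 (Section 3.4 of the paper): the singular metric `h` is equivalent to
`r²·eucl` over `ℝ²`, where `r² = x² + y²`; in particular `Q_{(x,y)}` is positive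
definite for every `(x, y) ≠ (0, 0)`.
-/
theorem statement_7 :
    ∃ a b : ℝ, 0 < a ∧ a ≤ b ∧
      (∀ x y u v : ℝ,
        a * ((x ^ 2 + y ^ 2) * (u ^ 2 + v ^ 2)) ≤ Qform x y u v ∧
        Qform x y u v ≤ b * ((x ^ 2 + y ^ 2) * (u ^ 2 + v ^ 2))) ∧
      (∀ x y : ℝ, (x, y) ≠ (0, 0) → ∀ u v : ℝ, (u, v) ≠ (0, 0) →
        0 < Qform x y u v) := by
  have hQ : ∀ x y u v : ℝ, Qform x y u v =
      ((x * u + y * v) + (x * v - y * u)) ^ 2 + (x * u + y * v) ^ 2 := by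
    intro x y u v
    unfold Qform
    ring
  have hN : ∀ x y u v : ℝ, (x ^ 2 + y ^ 2) * (u ^ 2 + v ^ 2) =
      (x * u + y * v) ^ 2 + (x * v - y * u) ^ 2 := by
    intro x y u v
    ring
  have hL : ∀ x y u v : ℝ,
      1 / 3 * ((x ^ 2 + y ^ 2) * (u ^ 2 + v ^ 2)) ≤ Qform x y u v := by
    intro x y u v
    rw [hQ, hN]
    generalize x * u + y * v = s
    generalize x * v - y * u = d
    nlinarith [sq_nonneg (3 * s + 2 * d), sq_nonneg s, sq_nonneg d]
  have hpos : ∀ x y : ℝ, (x, y) ≠ (0, 0) → 0 < x ^ 2 + y ^ 2 := by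
    intro x y h
    by_contra hc
    apply h
    have hx : x ^ 2 = 0 := by nlinarith [sq_nonneg x, sq_nonneg y]
    have hy : y ^ 2 = 0 := by nlinarith [sq_nonneg x, sq_nonneg y]
    rw [pow_eq_zero_iff two_ne_zero] at hx hy
    rw [hx, hy]
  refine ⟨1 / 3, 3, by norm_num, by norm_num, fun x y u v => ⟨hL x y u v, ?_⟩, ?_⟩
  · rw [hQ, hN]
    generalize x * u + y * v = s
    generalize x * v - y * u = d
    nlinarith [sq_nonneg (s - d), sq_nonneg d]
  · intro x y h u v h2
    have := mul_pos (hpos x y h) (hpos u v h2)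
    linarith [hL x y u v]
end
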